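/- Fix L : ℕ, a finite output alphabet, and let α = β = (Fin L → Bool). Let q be a probability mass function on α and, for each i : Fin L and each bit value x, let w_i(x, ·) be a probability mass function on Bool. Define the joint probability mass function p on α × β by p(x, y) = q(x) · Π_{i} w_i(x_i, y_i) (a memoryless channel acting independently on each coordinate). For each i, let p_i be the marginal joint probability mass function on Bool × Bool of the pair (x_i, y_i) under p. Then I(p) ≤ Σ_{i=0}^{L−1} I(p_i); that is, the mutual information through the L parallel channels is at most the sum of the per-coordinate mutual informations. (This is the parallel-channel subadditivity used in the proof of Theorem 2 to conclude C(δ,L) ≤ L·(1 − H(ε_δ)).) -/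

import Mathlib

open Finset

/-- Mutual information of a joint probability mass function `p` on `α × β`. -/
noncomputable def mutualInfo {α β : Type*} [Fintype α] [Fintype β] (p : α × β → ℝ) : ℝ :=
  ∑ x : α × β, p x * Real.log (p x / ((∑ b, p (x.1, b)) * (∑ a, p (a, x.2))))

/-- If every `f i` has total mass one, the `i`-th marginal of the product mass function
`y ↦ ∏ j, f j (y j)` is `f i`. -/
theorem sum_ite_apply_eq_prod {ι κ : Type*} [Fintype ι] [DecidableEq ι] [Fintype κ]
    [DecidableEq κ] (f : ι → κ → ℝ) (hf : ∀ i, ∑ v, f i v = 1) (i : ι) (v : κ) :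
    ∑ y : ι → κ, (if y i = v then ∏ j, f j (y j) else 0) = f i v := by
  have key : ∀ y : ι → κ, (if y i = v then ∏ j, f j (y j) else 0) =
      ∏ j, if j = i ∧ y j ≠ v then 0 else f j (y j) := by
    intro y
    split_ifs with h
    · refine prod_congr rfl fun j _ => ?_
      rw [if_neg]
      rintro ⟨rfl, h'⟩
      exact h' h
    · exact (prod_eq_zero (mem_univ i) (by simp [h])).symm
  rw [sum_congr rfl fun y _ => key y,
    ← Fintype.prod_sum fun j k => if j = i ∧ k ≠ v then 0 else f j k,
    prod_eq_single i]
  · simp [ite_not]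
  · intro j _ hj
    simp [hj, hf]
  · simp

/-- Summing against a marginal of `P` is summing against `P`. -/
theorem sum_marginal_mul {A B U V : Type*} [Fintype A] [Fintype B] [Fintype U] [Fintype V]
    [DecidableEq U] [DecidableEq V] (g : A → U) (h : B → V) (P : A → B → ℝ) (F : U × V → ℝ) :
    ∑ uv : U × V, (∑ x, ∑ y, if g x = uv.1 ∧ h y = uv.2 then P x y else 0) * F uv =
      ∑ xy : A × B, P xy.1 xy.2 * F (g xy.1, h xy.2) := by
  have key : ∀ uv : U × V,
      (∑ x, ∑ y, if g x = uv.1 ∧ h y = uv.2 then P x y else 0) * F uv =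
        ∑ xy : A × B, if (g xy.1, h xy.2) = uv then P xy.1 xy.2 * F uv else 0 := by
    intro uv
    rw [← Fintype.sum_prod_type'
      (f := fun x y => if g x = uv.1 ∧ h y = uv.2 then P x y else 0), sum_mul]
    refine sum_congr rfl fun xy _ => ?_
    simp only [Prod.ext_iff, ite_mul, zero_mul]
  rw [sum_congr rfl fun uv _ => key uv, sum_comm]
  simp

/-- The pointwise comparison of log-likelihood ratios: replacing the output mass `r` by the
product of the masses `s i` costs at most `(∏ i, s i) / r - 1`. -/
theorem log_div_le_sum_log_div {ι : Type*} [Fintype ι] {q r : ℝ} {w t s : ι → ℝ}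
    (hq : 0 < q) (hr : 0 < r) (hw : ∀ i, 0 < w i) (ht : ∀ i, 0 < t i) (hs : ∀ i, 0 < s i) :
    Real.log (q * (∏ i, w i) / (q * r)) ≤
      ∑ i, Real.log (t i * w i / (t i * s i)) + ((∏ i, s i) / r - 1) := by
  have hW : 0 < ∏ i, w i := prod_pos fun i _ => hw i
  have hS : 0 < ∏ i, s i := prod_pos fun i _ => hs i
  have hsum : ∑ i, Real.log (t i * w i / (t i * s i)) =
      Real.log (∏ i, w i) - Real.log (∏ i, s i) := by
    rw [Real.log_prod fun i _ => (hw i).ne', Real.log_prod fun i _ => (hs i).ne',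
      ← sum_sub_distrib]
    refine sum_congr rfl fun i _ => ?_
    rw [mul_div_mul_left _ _ (ht i).ne', Real.log_div (hw i).ne' (hs i).ne']
  have hlog := Real.log_le_sub_one_of_pos (div_pos hS hr)
  rw [Real.log_div hS.ne' hr.ne'] at hlog
  rw [hsum, mul_div_mul_left _ _ hq.ne', Real.log_div hW.ne' hr.ne']
  linarith

/-- Parallel-channel subadditivity: for a memoryless channel acting independently on
each of the `L` coordinates of an `L`-bit message, the mutual information between the
input `x` and output `y` (jointly distributed as `p (x, y) = q x * ∏ i, w i (x i) (y i)`)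
is at most the sum over the coordinates `i` of the mutual informations of the marginal
joint distributions of the pairs `(x i, y i)`. -/
theorem mutualInfo_le_sum_coords (L : ℕ)
    (q : (Fin L → Bool) → ℝ) (w : Fin L → Bool → Bool → ℝ)
    (hq_nonneg : ∀ x, 0 ≤ q x) (hq_sum : ∑ x, q x = 1)
    (hw_nonneg : ∀ i x y, 0 ≤ w i x y) (hw_sum : ∀ i x, ∑ y, w i x y = 1) :
    mutualInfo
        (fun xy : (Fin L → Bool) × (Fin L → Bool) => q xy.1 * ∏ i, w i (xy.1 i) (xy.2 i)) ≤
      ∑ i : Fin L,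
        mutualInfo (fun uv : Bool × Bool =>
          ∑ x : Fin L → Bool, ∑ y : Fin L → Bool,
            if x i = uv.1 ∧ y i = uv.2 then q x * ∏ j, w j (x j) (y j) else 0) := by
  set P : (Fin L → Bool) → (Fin L → Bool) → ℝ := fun x y => q x * ∏ j, w j (x j) (y j) with hP
  set qm : Fin L → Bool → ℝ := fun i u => ∑ x, if x i = u then q x else 0 with hqm
  set rm : Fin L → Bool → ℝ := fun i v => ∑ x, q x * w i (x i) v with hrm
  set r : (Fin L → Bool) → ℝ := fun y => ∑ x, P x y with hr
  have hP_nonneg : ∀ x y, 0 ≤ P x y := fun x y =>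
    mul_nonneg (hq_nonneg x) (prod_nonneg fun i _ => hw_nonneg i _ _)
  have hr_nonneg : ∀ y, 0 ≤ r y := fun y => sum_nonneg fun x _ => hP_nonneg x y
  have hrm_nonneg : ∀ i v, 0 ≤ rm i v := fun i v =>
    sum_nonneg fun x _ => mul_nonneg (hq_nonneg x) (hw_nonneg i _ _)
  have hP_sum : ∀ x, ∑ y, P x y = q x := by
    intro x
    simp only [hP]
    rw [← mul_sum, ← Fintype.prod_sum fun j k => w j (x j) k]
    simp only [hw_sum, prod_const_one, mul_one]
  have hrm_sum : ∀ i, ∑ v, rm i v = 1 := by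
    intro i
    simp only [hrm]
    rw [sum_comm]
    simp only [← mul_sum, hw_sum, mul_one, hq_sum]
  have hmarg : ∀ i u v,
      (∑ x, ∑ y : Fin L → Bool, if x i = u ∧ y i = v then P x y else 0) = qm i u * w i u v := by
    intro i u v
    simp only [hqm, sum_mul]
    refine sum_congr rfl fun x _ => ?_
    by_cases hx : x i = u
    · subst hx
      simp only [true_and, if_true, hP]
      rw [← sum_ite_apply_eq_prod (fun j => w j (x j)) (fun j => hw_sum j _) i v, mul_sum]
      simp only [mul_ite, mul_zero]
    · simp [hx]
  have hrow : ∀ i u, ∑ v, qm i u * w i u v = qm i u := fun i u => by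
    rw [← mul_sum, hw_sum, mul_one]
  have hcol : ∀ i v, ∑ u, qm i u * w i u v = rm i v := by
    intro i v
    simp only [hqm, hrm, sum_mul]
    rw [sum_comm]
    simp [ite_mul]
  have hcoord : ∀ i, mutualInfo (fun uv : Bool × Bool =>
        ∑ x : Fin L → Bool, ∑ y : Fin L → Bool,
          if x i = uv.1 ∧ y i = uv.2 then P x y else 0) =
      ∑ xy : (Fin L → Bool) × (Fin L → Bool), P xy.1 xy.2 *
        Real.log (qm i (xy.1 i) * w i (xy.1 i) (xy.2 i) /
          (qm i (xy.1 i) * rm i (xy.2 i))) := by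
    intro i
    rw [← sum_marginal_mul (fun x : Fin L → Bool => x i) (fun y : Fin L → Bool => y i) P
      fun uv => Real.log (qm i uv.1 * w i uv.1 uv.2 / (qm i uv.1 * rm i uv.2))]
    simp only [mutualInfo, hmarg, hrow, hcol]
  have hpoint : ∀ x y, P x y * Real.log (P x y / (q x * r y)) ≤
      ∑ i, P x y * Real.log (qm i (x i) * w i (x i) (y i) / (qm i (x i) * rm i (y i))) +
        (P x y * ((∏ i, rm i (y i)) / r y) - P x y) := by
    intro x y
    rcases (hP_nonneg x y).eq_or_lt with h0 | hpos
    · simp [← h0]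
    have hq : 0 < q x := (hq_nonneg x).lt_of_ne fun h => by simp [hP, ← h] at hpos
    have hw : ∀ i, 0 < w i (x i) (y i) := fun i =>
      (hw_nonneg i _ _).lt_of_ne fun h =>
        hpos.ne' (mul_eq_zero_of_right _ (prod_eq_zero (mem_univ i) h.symm))
    have hry : 0 < r y :=
      hpos.trans_le (single_le_sum (fun x _ => hP_nonneg x y) (mem_univ x))
    have hqi : ∀ i, 0 < qm i (x i) := fun i =>
      sum_pos' (fun z _ => by split_ifs <;> simp [hq_nonneg]) ⟨x, mem_univ x, by simpa using hq⟩
    have hri : ∀ i, 0 < rm i (y i) := fun i =>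
      sum_pos' (fun z _ => mul_nonneg (hq_nonneg z) (hw_nonneg i _ _))
        ⟨x, mem_univ x, mul_pos hq (hw i)⟩
    have h := mul_le_mul_of_nonneg_left
      (log_div_le_sum_log_div hq hry hw hqi hri) hpos.le
    rw [mul_add, mul_sub, mul_one] at h
    rw [← mul_sum]
    exact h
  have herr : ∑ xy : (Fin L → Bool) × (Fin L → Bool),
      (P xy.1 xy.2 * ((∏ i, rm i (xy.2 i)) / r xy.2) - P xy.1 xy.2) ≤ 0 := by
    rw [sum_sub_distrib, sub_nonpos]
    calc ∑ xy : (Fin L → Bool) × (Fin L → Bool),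
          P xy.1 xy.2 * ((∏ i, rm i (xy.2 i)) / r xy.2)
        = ∑ y, r y * ((∏ i, rm i (y i)) / r y) := by
          rw [Fintype.sum_prod_type_right]
          simp only [← sum_mul, hr]
      _ ≤ ∑ y : Fin L → Bool, ∏ i, rm i (y i) := by
          refine sum_le_sum fun y _ => ?_
          rcases (hr_nonneg y).eq_or_lt with h0 | hpos
          · rw [← h0, zero_mul]
            exact prod_nonneg fun i _ => hrm_nonneg i _
          · rw [mul_div_cancel₀ _ hpos.ne']
      _ = 1 := by
          rw [← Fintype.prod_sum rm]
          simp only [hrm_sum, prod_const_one]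
      _ = ∑ xy : (Fin L → Bool) × (Fin L → Bool), P xy.1 xy.2 := by
          rw [Fintype.sum_prod_type]
          simp only [hP_sum, hq_sum]
  calc mutualInfo (fun xy : (Fin L → Bool) × (Fin L → Bool) => P xy.1 xy.2)
      = ∑ xy : (Fin L → Bool) × (Fin L → Bool),
          P xy.1 xy.2 * Real.log (P xy.1 xy.2 / (q xy.1 * r xy.2)) := by
        simp only [mutualInfo, hP_sum, hr]
    _ ≤ _ := sum_le_sum fun xy _ => hpoint xy.1 xy.2
    _ ≤ _ := by
        rw [sum_add_distrib, sum_comm, ← sum_congr rfl fun i _ => hcoord i]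
        linarith
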